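/- Let 𝓕 be a Kalton space on U with values in Σ and let z ∈ U. Then for every g ∈ ker δ_z one has g'(z) ∈ X_z; the map δ'_z : ker δ_z → X_z, g ↦ g'(z), is a bounded linear operator (from the norm of 𝓕 to the quotient norm of X_z) and it is surjective onto X_z. -/

import Mathlib

open Complex Metric Set

noncomputable section

/-- A conformal equivalence (analytic bijection) of `U` onto `V`. -/
def ConformalEquivOn (φ : ℂ → ℂ) (U V : Set ℂ) : Prop :=
  DifferentiableOn ℂ φ U ∧ Set.BijOn φ U V

/-- A Kalton space of analytic functions on an open set `U ⊆ ℂ` conformally equivalent to the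
open unit disc, with values in the complex Banach space `Sig`.  The Banach carrier is `F`, whose
elements are identified with analytic functions `ℂ → Sig` (only the restriction to `U` matters)
via the injective linear map `toFun`. -/
structure KaltonSpace (U : Set ℂ) (Sig : Type*) (F : Type*)
    [NormedAddCommGroup Sig] [NormedSpace ℂ Sig] [CompleteSpace Sig]
    [NormedAddCommGroup F] [NormedSpace ℂ F] [CompleteSpace F] where
  isOpen : IsOpen U
  conformal_exists : ∃ φ : ℂ → ℂ, ConformalEquivOn φ U (Metric.ball (0 : ℂ) 1)
  toFun : F →ₗ[ℂ] (ℂ → Sig)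
  inj : ∀ f g : F, Set.EqOn (toFun f) (toFun g) U → f = g
  analytic : ∀ f : F, DifferentiableOn ℂ (toFun f) U
  eval_bound : ∀ z ∈ U, ∃ C : ℝ, ∀ f : F, ‖toFun f z‖ ≤ C * ‖f‖
  conf_mul_mem : ∀ φ : ℂ → ℂ, ConformalEquivOn φ U (Metric.ball (0 : ℂ) 1) →
    ∀ f : F, ∃ g : F, (∀ z ∈ U, toFun g z = φ z • toFun f z) ∧ ‖g‖ = ‖f‖
  conf_div_mem : ∀ φ : ℂ → ℂ, ConformalEquivOn φ U (Metric.ball (0 : ℂ) 1) →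
    ∀ h : ℂ → Sig, DifferentiableOn ℂ h U →
    ∀ g : F, (∀ z ∈ U, toFun g z = φ z • h z) →
    ∃ f : F, (∀ z ∈ U, toFun f z = h z) ∧ ‖f‖ = ‖g‖

namespace KaltonSpace

variable {U : Set ℂ} {Sig F : Type*}
  [NormedAddCommGroup Sig] [NormedSpace ℂ Sig] [CompleteSpace Sig]
  [NormedAddCommGroup F] [NormedSpace ℂ F] [CompleteSpace F]

/-- `x` belongs to the interpolation space `X_z = {f z : f ∈ 𝓕}`. -/
def MemX (K : KaltonSpace U Sig F) (z : ℂ) (x : Sig) : Prop :=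
  ∃ f : F, K.toFun f z = x

/-- The quotient norm `‖x‖_z = inf {‖f‖ : f ∈ 𝓕, f z = x}` of `X_z`. -/
def normX (K : KaltonSpace U Sig F) (z : ℂ) (x : Sig) : ℝ :=
  sInf {r : ℝ | ∃ f : F, K.toFun f z = x ∧ r = ‖f‖}

/-- `B` is a homogeneous bounded selection for the evaluation `δ_z`, with constant `c`. -/
def IsSelection (K : KaltonSpace U Sig F) (z : ℂ) (c : ℝ) (B : Sig → F) : Prop :=
  (∀ (l : ℂ) (x : Sig), K.MemX z x → B (l • x) = l • B x) ∧
  (∀ x : Sig, K.MemX z x → K.toFun (B x) z = x) ∧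
  (∀ x : Sig, K.MemX z x → ‖B x‖ ≤ c * K.normX z x)

end KaltonSpace

open Filter Topology ComplexConjugate

/-- An injective holomorphic function on an open set has nonvanishing derivative. -/
theorem deriv_ne_zero_of_injOn {U : Set ℂ} (hU : IsOpen U) {φ : ℂ → ℂ}
    (hd : DifferentiableOn ℂ φ U) (hi : InjOn φ U) {z : ℂ} (hz : z ∈ U) : deriv φ z ≠ 0 := by
  have han : ∀ w ∈ U, AnalyticAt ℂ φ w := fun w hw => hd.analyticAt (hU.mem_nhds hw)
  have hnc : ∀ w ∈ U, ¬ ∀ᶠ y in 𝓝 w, φ y = φ w := by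
    intro w hw h
    have h1 : ∀ᶠ y in 𝓝[≠] w, y = w := by
      filter_upwards [h.filter_mono nhdsWithin_le_nhds,
        nhdsWithin_le_nhds (hU.mem_nhds hw)] with y hy hyU
      exact hi hyU hw hy
    obtain ⟨y, hy, hy'⟩ := (h1.and self_mem_nhdsWithin).exists
    exact hy' hy
  have hopen : ∀ w ∈ U, 𝓝 (φ w) ≤ map φ (𝓝 w) := fun w hw =>
    ((han w hw).eventually_constant_or_nhds_le_map_nhds).resolve_left (hnc w hw)
  set ψ := Function.invFunOn φ U
  have hleft : ∀ w ∈ U, ψ (φ w) = w := fun w hw => hi.leftInvOn_invFunOn hw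
  have hleft' : ∀ w ∈ U, ψ ∘ φ =ᶠ[𝓝 w] id := by
    intro w hw
    filter_upwards [hU.mem_nhds hw] with y hy using hleft y hy
  have hcont : ∀ w ∈ U, ContinuousAt ψ (φ w) := by
    intro w hw
    unfold ContinuousAt Tendsto
    rw [hleft w hw]
    calc map ψ (𝓝 (φ w)) ≤ map ψ (map φ (𝓝 w)) := map_mono (hopen w hw)
      _ = 𝓝 w := by rw [map_map, map_congr (hleft' w hw), map_id]
  have hright : ∀ w ∈ U, ∀ᶠ y in 𝓝 (φ w), φ (ψ y) = y := by
    intro w hw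
    filter_upwards [hopen w hw (image_mem_map (hU.mem_nhds hw))]
    rintro _ ⟨y, hy, rfl⟩
    rw [hleft y hy]
  have hpunct : ∀ᶠ w in 𝓝[≠] z, deriv φ w ≠ 0 := by
    refine (han z hz).deriv.eventually_eq_zero_or_eventually_ne_zero.resolve_left fun h => ?_
    obtain ⟨r, hr, hball⟩ := Metric.eventually_nhds_iff_ball.1 (h.and (hU.mem_nhds hz))
    refine hnc z hz ?_
    filter_upwards [Metric.ball_mem_nhds z hr] with y hy
    exact Metric.isOpen_ball.is_const_of_deriv_eq_zero (convex_ball z r).isPreconnected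
      (hd.mono fun w hw => (hball w hw).2) (fun w hw => (hball w hw).1) hy
      (Metric.mem_ball_self hr)
  have hV : {w | w ∈ U ∧ (w ≠ z → deriv φ w ≠ 0)} ∈ 𝓝 z := by
    filter_upwards [hU.mem_nhds hz, eventually_nhdsWithin_iff.1 hpunct] with w hw hw'
    exact ⟨hw, hw'⟩
  have hS := hopen z hz (image_mem_map hV)
  have hψd : DifferentiableAt ℂ ψ (φ z) := by
    refine ((differentiableOn_compl_singleton_and_continuousAt_iff hS).1
      ⟨?_, hcont z hz⟩).differentiableAt hS
    rintro _ ⟨⟨w, ⟨hw, hw'⟩, rfl⟩, hne⟩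
    have hwz : w ≠ z := fun h => hne (congrArg φ h)
    refine (HasDerivAt.of_local_left_inverse (f := φ) (f' := deriv φ w) (hcont w hw) ?_
      (hw' hwz) (hright w hw)).differentiableAt.differentiableWithinAt
    rw [hleft w hw]
    exact (han w hw).differentiableAt.hasDerivAt
  have h1 : HasDerivAt (ψ ∘ φ) (deriv ψ (φ z) * deriv φ z) z :=
    hψd.hasDerivAt.comp z (han z hz).differentiableAt.hasDerivAt
  have h2 : HasDerivAt (ψ ∘ φ) 1 z := (hasDerivAt_id z).congr_of_eventuallyEq (hleft' z hz)
  intro h0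
  simpa [h0] using h1.unique h2

theorem one_sub_conj_mul_ne_zero {a w : ℂ} (ha : ‖a‖ < 1) (hw : ‖w‖ < 1) :
    1 - conj a * w ≠ 0 := by
  intro h
  have h1 : ‖conj a * w‖ = 1 := by rw [← sub_eq_zero.1 h, norm_one]
  rw [norm_mul, RCLike.norm_conj] at h1
  nlinarith [norm_nonneg a, norm_nonneg w]

theorem norm_mobius_lt_one {a w : ℂ} (ha : ‖a‖ < 1) (hw : ‖w‖ < 1) :
    ‖(w - a) / (1 - conj a * w)‖ < 1 := by
  rw [norm_div, div_lt_one (norm_pos_iff.2 (one_sub_conj_mul_ne_zero ha hw))]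
  refine lt_of_pow_lt_pow_left₀ 2 (norm_nonneg _) ?_
  have ha2 : ‖a‖ ^ 2 < 1 := by nlinarith [norm_nonneg a]
  have hw2 : ‖w‖ ^ 2 < 1 := by nlinarith [norm_nonneg w]
  rw [Complex.sq_norm, Complex.normSq_apply] at ha2 hw2 ⊢
  rw [Complex.sq_norm, Complex.normSq_apply]
  simp only [sub_re, sub_im, one_re, one_im, mul_re, mul_im, conj_re, conj_im]
  nlinarith [mul_pos (sub_pos.2 ha2) (sub_pos.2 hw2)]

theorem mobius_leftInvOn {a : ℂ} (ha : ‖a‖ < 1) :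
    LeftInvOn (fun w => (w - -a) / (1 - conj (-a) * w))
      (fun w => (w - a) / (1 - conj a * w)) (ball 0 1) := by
  intro w hw
  have hw' : ‖w‖ < 1 := mem_ball_zero_iff.1 hw
  have h1 := one_sub_conj_mul_ne_zero ha hw'
  have h2 := one_sub_conj_mul_ne_zero (a := -a) (by rwa [norm_neg]) (norm_mobius_lt_one ha hw')
  simp only
  rw [div_eq_iff h2]
  simp only [map_neg]
  linear_combination div_mul_cancel₀ (w - a) h1

theorem conformalEquivOn_mobius {a : ℂ} (ha : ‖a‖ < 1) :
    ConformalEquivOn (fun w => (w - a) / (1 - conj a * w)) (ball 0 1) (ball 0 1) := by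
  have hmaps : ∀ b : ℂ, ‖b‖ < 1 →
      MapsTo (fun w => (w - b) / (1 - conj b * w)) (ball 0 1) (ball 0 1) := fun b hb w hw =>
    mem_ball_zero_iff.2 (norm_mobius_lt_one hb (mem_ball_zero_iff.1 hw))
  have ha' : ‖-a‖ < 1 := by rwa [norm_neg]
  refine ⟨?_, InvOn.bijOn ⟨mobius_leftInvOn ha, ?_⟩ (hmaps a ha) (hmaps (-a) ha')⟩
  · exact DifferentiableOn.fun_div (by fun_prop) (by fun_prop) fun w hw =>
      one_sub_conj_mul_ne_zero ha (mem_ball_zero_iff.1 hw)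
  · simpa only [neg_neg] using mobius_leftInvOn ha'

theorem ConformalEquivOn.comp {φ ψ : ℂ → ℂ} {U V W : Set ℂ} (hψ : ConformalEquivOn ψ V W)
    (hφ : ConformalEquivOn φ U V) : ConformalEquivOn (ψ ∘ φ) U W :=
  ⟨hψ.1.comp hφ.1 hφ.2.mapsTo, hψ.2.comp hφ.2⟩

namespace KaltonSpace

variable {U : Set ℂ} {Sig F : Type*}
  [NormedAddCommGroup Sig] [NormedSpace ℂ Sig] [CompleteSpace Sig]
  [NormedAddCommGroup F] [NormedSpace ℂ F] [CompleteSpace F]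

theorem exists_conformalEquivOn_eq_zero (K : KaltonSpace U Sig F) {z : ℂ} (hz : z ∈ U) :
    ∃ φ : ℂ → ℂ, ConformalEquivOn φ U (ball 0 1) ∧ φ z = 0 := by
  obtain ⟨φ, hφ⟩ := K.conformal_exists
  exact ⟨_, (conformalEquivOn_mobius (mem_ball_zero_iff.1 (hφ.2.mapsTo hz))).comp hφ, by simp⟩

theorem differentiableAt (K : KaltonSpace U Sig F) {z : ℂ} (hz : z ∈ U) (f : F) :
    DifferentiableAt ℂ (K.toFun f) z :=
  (K.analytic f).differentiableAt (K.isOpen.mem_nhds hz)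

/-- Elements of `𝓕` vanishing at `z` can be divided isometrically by a conformal equivalence
vanishing at `z`. -/
theorem exists_smul_eq_deriv (K : KaltonSpace U Sig F) {z : ℂ} (hz : z ∈ U) {φ : ℂ → ℂ}
    (hφ : ConformalEquivOn φ U (ball 0 1)) (hφz : φ z = 0) {g : F} (hg : K.toFun g z = 0) :
    ∃ f : F, deriv φ z • K.toFun f z = deriv (K.toFun g) z ∧ ‖f‖ = ‖g‖ := by
  have hU := K.isOpen.mem_nhds hz
  have hne : ∀ w ∈ U, dslope φ z w ≠ 0 := by
    intro w hw
    rcases eq_or_ne w z with rfl | h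
    · rw [dslope_same]
      exact deriv_ne_zero_of_injOn K.isOpen hφ.1 hφ.2.injOn hz
    · intro h0
      have := sub_smul_dslope φ z w
      rw [h0, smul_zero, eq_comm, sub_eq_zero] at this
      exact h (hφ.2.injOn hw hz this)
  obtain ⟨f, hf, hn⟩ := K.conf_div_mem φ hφ (fun w => (dslope φ z w)⁻¹ • dslope (K.toFun g) z w)
    ((((differentiableOn_dslope hU).2 hφ.1).fun_inv hne).fun_smul
      ((differentiableOn_dslope hU).2 (K.analytic g))) g (fun w hw => by
        have h1 := sub_smul_dslope φ z w
        have h2 := sub_smul_dslope (K.toFun g) z w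
        rw [hφz, sub_zero] at h1
        rw [hg, sub_zero] at h2
        rw [← h1, ← h2, smul_eq_mul, mul_smul, smul_inv_smul₀ (hne w hw)])
  refine ⟨f, ?_, hn⟩
  have hz0 := hne z hz
  rw [hf z hz]
  simp only [dslope_same] at hz0 ⊢
  rw [smul_inv_smul₀ hz0]

theorem exists_eq_zero_deriv_eq_smul (K : KaltonSpace U Sig F) {z : ℂ} (hz : z ∈ U) {φ : ℂ → ℂ}
    (hφ : ConformalEquivOn φ U (ball 0 1)) (hφz : φ z = 0) (f : F) :
    ∃ g : F, K.toFun g z = 0 ∧ deriv (K.toFun g) z = deriv φ z • K.toFun f z := by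
  obtain ⟨g, hg, -⟩ := K.conf_mul_mem φ hφ f
  refine ⟨g, by rw [hg z hz, hφz, zero_smul], ?_⟩
  have hU := K.isOpen.mem_nhds hz
  have h : K.toFun g =ᶠ[𝓝 z] fun w => φ w • K.toFun f w := by
    filter_upwards [hU] with w hw using hg w hw
  rw [h.deriv_eq, deriv_fun_smul (hφ.1.differentiableAt hU) (K.differentiableAt hz f), hφz,
    zero_smul, zero_add]

theorem normX_le (K : KaltonSpace U Sig F) {z : ℂ} {x : Sig} {f : F} (hf : K.toFun f z = x) :
    K.normX z x ≤ ‖f‖ :=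
  csInf_le ⟨0, by rintro _ ⟨f, -, rfl⟩; exact norm_nonneg f⟩ ⟨f, hf, rfl⟩

end KaltonSpace

/-- For every `g ∈ ker δ_z` one has `g'(z) ∈ X_z`; the map `δ'_z : ker δ_z → X_z`, `g ↦ g'(z)`,
is a bounded linear operator (from the norm of `𝓕` to the quotient norm of `X_z`) and it is
surjective onto `X_z`. -/
theorem statement7 (U : Set ℂ) (Sig F : Type*)
    [NormedAddCommGroup Sig] [NormedSpace ℂ Sig] [CompleteSpace Sig]
    [NormedAddCommGroup F] [NormedSpace ℂ F] [CompleteSpace F]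
    (K : KaltonSpace U Sig F) (z : ℂ) (hz : z ∈ U) :
    (∀ g : F, K.toFun g z = 0 → K.MemX z (deriv (K.toFun g) z)) ∧
    (∀ f g : F, deriv (K.toFun (f + g)) z = deriv (K.toFun f) z + deriv (K.toFun g) z) ∧
    (∀ (c : ℂ) (f : F), deriv (K.toFun (c • f)) z = c • deriv (K.toFun f) z) ∧
    (∃ C : ℝ, ∀ g : F, K.toFun g z = 0 → K.normX z (deriv (K.toFun g) z) ≤ C * ‖g‖) ∧
    (∀ x : Sig, K.MemX z x → ∃ g : F, K.toFun g z = 0 ∧ deriv (K.toFun g) z = x) := by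
  obtain ⟨φ, hφ, hφz⟩ := K.exists_conformalEquivOn_eq_zero hz
  have hd : deriv φ z ≠ 0 := deriv_ne_zero_of_injOn K.isOpen hφ.1 hφ.2.injOn hz
  have key : ∀ g : F, K.toFun g z = 0 →
      ∃ f : F, K.toFun f z = deriv (K.toFun g) z ∧ ‖f‖ = ‖deriv φ z‖ * ‖g‖ := by
    intro g hg
    obtain ⟨f, hf, hn⟩ := K.exists_smul_eq_deriv hz hφ hφz hg
    exact ⟨deriv φ z • f, by rw [map_smul, Pi.smul_apply, hf], by rw [norm_smul, hn]⟩
  refine ⟨fun g hg => ?_, fun f g => ?_, fun c f => ?_, ⟨‖deriv φ z‖, fun g hg => ?_⟩, ?_⟩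
  · obtain ⟨f, hf, -⟩ := key g hg
    exact ⟨f, hf⟩
  · rw [map_add, deriv_add (K.differentiableAt hz f) (K.differentiableAt hz g)]
  · rw [map_smul, deriv_const_smul c (K.differentiableAt hz f)]
  · obtain ⟨f, hf, hn⟩ := key g hg
    exact hn ▸ K.normX_le hf
  · rintro x ⟨f, rfl⟩
    obtain ⟨g, hg, hg'⟩ := K.exists_eq_zero_deriv_eq_smul hz hφ hφz ((deriv φ z)⁻¹ • f)
    exact ⟨g, hg, by rw [hg', map_smul, Pi.smul_apply, smul_inv_smul₀ hd]⟩
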